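/- Conditional informed-guess value for the outer parties when Bob performs the separable measurement σz⊗σz: with ρ = |Ψ⁻⟩⟨Ψ⁻| ⊗ |Ψ⁻⟩⟨Ψ⁻| (16×16 matrix, ordering A,B₁,B₂,C) and Q⁰_± = ½(I₄ ± σz⊗σz), one has Σ_{s∈{+,−}} max_{a,c∈{0,1}} Tr[ρ·(Π⁰_a ⊗ Q⁰_s ⊗ Π⁰_c)] = 3/8. (This is the probability of correctly guessing Alice's and Charlie's outcomes by betting on the most probable pair for each of Bob's outcomes, corresponding to at most log₂(8/3) ≈ 1.41 certifiable bits.) -/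

import Mathlib

open Matrix Kronecker

noncomputable section

abbrev M2 := Matrix (Fin 2) (Fin 2) ℂ
abbrev M4 := Matrix (Fin 2 × Fin 2) (Fin 2 × Fin 2) ℂ
abbrev Quad := Fin 2 × Fin 2 × Fin 2 × Fin 2
abbrev M16 := Matrix Quad Quad ℂ

/-- Pauli Z matrix. -/
def σz : M2 := !![1, 0; 0, -1]
/-- Pauli X matrix. -/
def σx : M2 := !![0, 1; 1, 0]

/-- The complex number 1/√2. -/
def invSqrt2 : ℂ := ((Real.sqrt 2 : ℝ) : ℂ)⁻¹

/-- Bell state Φ⁺ = (|00⟩+|11⟩)/√2. -/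
def PhiP : Fin 2 × Fin 2 → ℂ := fun p =>
  if p = (0, 0) then invSqrt2 else if p = (1, 1) then invSqrt2 else 0
/-- Bell state Φ⁻ = (|00⟩−|11⟩)/√2. -/
def PhiM : Fin 2 × Fin 2 → ℂ := fun p =>
  if p = (0, 0) then invSqrt2 else if p = (1, 1) then -invSqrt2 else 0
/-- Bell state Ψ⁺ = (|01⟩+|10⟩)/√2. -/
def PsiP : Fin 2 × Fin 2 → ℂ := fun p =>
  if p = (0, 1) then invSqrt2 else if p = (1, 0) then invSqrt2 else 0
/-- Bell state Ψ⁻ = (|01⟩−|10⟩)/√2. -/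
def PsiM : Fin 2 × Fin 2 → ℂ := fun p =>
  if p = (0, 1) then invSqrt2 else if p = (1, 0) then -invSqrt2 else 0

/-- Rank-one projector |ψ⟩⟨ψ|. -/
def proj {n : Type*} (ψ : n → ℂ) : Matrix n n ℂ := vecMulVec ψ (star ψ)

/-- The four Bell states, ordered Φ⁺, Φ⁻, Ψ⁺, Ψ⁻. -/
def Bell : Fin 4 → (Fin 2 × Fin 2 → ℂ) := ![PhiP, PhiM, PsiP, PsiM]

/-- Projectors onto the Bell states. -/
def P (b : Fin 4) : M4 := proj (Bell b)

/-- Kronecker product M_A ⊗ M_{B₁B₂} ⊗ M_C, in the tensor ordering A, B₁, B₂, C. -/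
def kron3 (MA : M2) (MB : M4) (MC : M2) : M16 := fun p q =>
  MA p.1 q.1 * MB (p.2.1, p.2.2.1) (q.2.1, q.2.2.1) * MC p.2.2.2 q.2.2.2

/-- The two-singlet state vector |Ψ⁻⟩_{AB₁} ⊗ |Ψ⁻⟩_{B₂C}. -/
def twoSinglets : Quad → ℂ := fun p => PsiM (p.1, p.2.1) * PsiM (p.2.2.1, p.2.2.2)

/-- The density matrix ρ = |Ψ⁻⟩⟨Ψ⁻| ⊗ |Ψ⁻⟩⟨Ψ⁻| on A, B₁, B₂, C. -/
def ρ₂ : M16 := proj twoSinglets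

/-- Spectral projectors Πˣ_a = ½(I₂ + (−1)^a (σz + (−1)^x σx)/√2) of the
observables (σz ± σx)/√2. -/
def Proj (x a : Fin 2) : M2 :=
  (1 / 2 : ℂ) • ((1 : M2) + (((-1 : ℂ) ^ (a : ℕ)) * invSqrt2) • (σz + ((-1 : ℂ) ^ (x : ℕ)) • σx))

/-- Eigenprojectors Qʸ_s = ½(I₄ + (−1)^s σ⊗σ) of σz⊗σz (y = 0) and σx⊗σx (y = 1);
s = 0 is the "+" projector and s = 1 the "−" projector. -/
def Q (y s : Fin 2) : M4 :=
  (1 / 2 : ℂ) • ((1 : M4) + ((-1 : ℂ) ^ (s : ℕ)) • (if y = 0 then σz ⊗ₖ σz else σx ⊗ₖ σx))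

/-- Correlator ⟨ψ|(A ⊗ C)|ψ⟩ of two single-qubit observables on a two-qubit state. -/
def corr (ψ : Fin 2 × Fin 2 → ℂ) (A C : M2) : ℂ := star ψ ⬝ᵥ ((A ⊗ₖ C) *ᵥ ψ)
lemma invSqrt2_sq : invSqrt2 * invSqrt2 = 1 / 2 := by
  unfold invSqrt2
  rw [← mul_inv, ← Complex.ofReal_mul, Real.mul_self_sqrt (by norm_num)]
  norm_num

lemma star_invSqrt2 : (starRingEnd ℂ) invSqrt2 = invSqrt2 := by
  unfold invSqrt2
  rw [map_inv₀, Complex.conj_ofReal]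

lemma trace_val (s a c : Fin 2) :
    trace (ρ₂ * kron3 (Proj 0 a) (Q 0 s) (Proj 0 c))
      = (((1 + (-1) ^ (s : ℕ) * (-1) ^ (a : ℕ) * (-1) ^ (c : ℕ) / 2) / 8 : ℝ) : ℂ) := by
  have h := invSqrt2_sq
  push_cast
  generalize hs : ((-1 : ℂ) ^ (s : ℕ)) = S
  generalize ha : ((-1 : ℂ) ^ (a : ℕ)) = A
  generalize hc : ((-1 : ℂ) ^ (c : ℕ)) = C
  simp [trace, Matrix.mul_apply, Fintype.sum_prod_type, ρ₂, proj, vecMulVec_apply, twoSinglets,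
    PsiM, kron3, Proj, Q, σz, σx, star_invSqrt2, hs, ha, hc, Matrix.one_apply]
  generalize invSqrt2 = t at *
  have h2 : t ^ 2 = 1 / 2 := by rw [pow_two, h]
  have h4 : t ^ 4 = 1 / 4 := by rw [show t ^ 4 = (t ^ 2) ^ 2 by ring, h2]; norm_num
  have h6 : t ^ 6 = 1 / 8 := by rw [show t ^ 6 = (t ^ 2) ^ 3 by ring, h2]; norm_num
  ring_nf
  simp only [h4, h6]
  ring

lemma iSup_fin2 (f : Fin 2 → ℝ) : (⨆ i, f i) = max (f 0) (f 1) := by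
  apply le_antisymm
  · apply ciSup_le
    intro i
    fin_cases i <;> simp
  · exact max_le (le_ciSup (Set.finite_range f).bddAbove 0)
      (le_ciSup (Set.finite_range f).bddAbove 1)

/-- Conditional informed-guess value for the outer parties when Bob measures σz⊗σz:
Σ_s max_{a,c} Tr[ρ·(Π⁰_a ⊗ Q⁰_s ⊗ Π⁰_c)] = 3/8 (s = 0 is the "+" outcome,
s = 1 the "−" outcome). -/
theorem informed_guess_AC_separable :
    ∑ s : Fin 2, (⨆ a : Fin 2, ⨆ c : Fin 2,
      (trace (ρ₂ * kron3 (Proj 0 a) (Q 0 s) (Proj 0 c))).re) = 3 / 8 := by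
  simp only [trace_val, Complex.ofReal_re, iSup_fin2, Fin.sum_univ_two]
  norm_num
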